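/- Fix q ∈ [1,∞] and let p satisfy 1/p + 1/q = 1. Consider binary classification data (X_i,Y_i) with X_i ∈ ℝ^d and Y_i ∈ {−1,+1}, and the cost c((x,y),(u,v)) = N_q((x,y),(u,v)). Then for the hinge loss (support vector machines), for every δ > 0: min_{β ∈ ℝ^d} sup { E_P[(1 − Y βᵀX)^+] : D_c(P,P_n) ≤ δ } = min_{β ∈ ℝ^d} { (1/n) Σ_{i=1}^n (1 − Y_i βᵀX_i)^+ + δ ‖β‖_p }, where x^+ = max(x,0). -/

import Mathlib

open MeasureTheory ProbabilityTheory Filter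
open scoped ENNReal NNReal Topology

noncomputable section

/-- The ℓ_p norm on `Fin d → ℝ`, for `p ∈ [1,∞]`. -/
def lpNorm (p : ℝ≥0∞) {d : ℕ} (x : Fin d → ℝ) : ℝ :=
  if p = ⊤ then ⨆ i, |x i| else (∑ i, |x i| ^ p.toReal) ^ (1 / p.toReal)

/-- Optimal transport discrepancy with cost `c`. -/
def OTCost {α : Type*} [MeasurableSpace α] (c : α → α → ℝ≥0∞) (P Q : Measure α) : ℝ≥0∞ :=
  ⨅ (π : Measure (α × α)) (_ : IsProbabilityMeasure π) (_ : π.map Prod.fst = P)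
    (_ : π.map Prod.snd = Q), ∫⁻ z, c z.1 z.2 ∂π

/-- Empirical measure of the points `W 0, …, W (n-1)`. -/
def empMeas {α : Type*} [MeasurableSpace α] {n : ℕ} (W : Fin n → α) : Measure α :=
  (n : ℝ≥0∞)⁻¹ • ∑ i, Measure.dirac (W i)

/-- Extended-real-valued expectation `E_P[l]`, defined via positive and negative parts. -/
def eExp {α : Type*} [MeasurableSpace α] (P : Measure α) (l : α → ℝ) : EReal :=
  ((∫⁻ z, ENNReal.ofReal (l z) ∂P : ℝ≥0∞) : EReal)
    - ((∫⁻ z, ENNReal.ofReal (-(l z)) ∂P : ℝ≥0∞) : EReal)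

lemma pi_lpNorm_top {d : ℕ} (x : Fin d → ℝ) : lpNorm ⊤ x = ⨆ i, |x i| := by
  simp [_root_.lpNorm]

lemma pi_lpNorm_one {d : ℕ} (x : Fin d → ℝ) : lpNorm 1 x = ∑ i, |x i| := by
  simp [_root_.lpNorm]

lemma pi_lpNorm_of_ne_top {p : ℝ≥0∞} (hp : p ≠ ⊤) {d : ℕ} (x : Fin d → ℝ) :
    lpNorm p x = (∑ i, |x i| ^ p.toReal) ^ (1 / p.toReal) := by
  simp [_root_.lpNorm, hp]

lemma pi_lpNorm_nonneg (p : ℝ≥0∞) {d : ℕ} (x : Fin d → ℝ) : 0 ≤ lpNorm p x := by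
  unfold _root_.lpNorm
  split_ifs
  · exact Real.iSup_nonneg fun i => abs_nonneg _
  · positivity

lemma pi_lpNorm_smul {p : ℝ≥0∞} (hp : 1 ≤ p) {d : ℕ} (a : ℝ) (x : Fin d → ℝ) :
    lpNorm p (a • x) = |a| * lpNorm p x := by
  by_cases htop : p = ⊤
  · subst htop
    simp only [pi_lpNorm_top, Pi.smul_apply, smul_eq_mul, abs_mul]
    exact (Real.mul_iSup_of_nonneg (abs_nonneg a) _).symm
  · have hp0 : 0 < p.toReal := ENNReal.toReal_pos (zero_lt_one.trans_le hp).ne' htop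
    simp only [pi_lpNorm_of_ne_top htop, Pi.smul_apply, smul_eq_mul, abs_mul]
    simp_rw [Real.mul_rpow (abs_nonneg a) (abs_nonneg _), ← Finset.mul_sum]
    rw [Real.mul_rpow (by positivity) (by positivity), ← Real.rpow_mul (abs_nonneg a),
      mul_one_div_cancel hp0.ne', Real.rpow_one]

/-- Two conjugate exponents are `(∞, 1)`, `(1, ∞)`, or both finite and conjugate as reals. -/
lemma conjugate_cases {p q : ℝ≥0∞} (hpq : p⁻¹ + q⁻¹ = 1) :
    (p = ⊤ ∧ q = 1) ∨ (p = 1 ∧ q = ⊤) ∨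
      (p ≠ ⊤ ∧ q ≠ ⊤ ∧ p.toReal.HolderConjugate q.toReal) := by
  by_cases hp : p = ⊤
  · subst hp
    left
    simpa using hpq
  by_cases hq : q = ⊤
  · subst hq
    right; left
    simpa using hpq
  right; right
  refine ⟨hp, hq, ?_⟩
  have : p.HolderConjugate q := ENNReal.holderConjugate_iff.2 hpq
  exact ENNReal.HolderConjugate.toReal_of_ne_top hp hq

lemma abs_sum_mul_le_sum_mul_iSup {d : ℕ} (x y : Fin d → ℝ) :
    |∑ j, x j * y j| ≤ (∑ j, |x j|) * ⨆ j, |y j| := by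
  rw [Finset.sum_mul]
  refine (Finset.abs_sum_le_sum_abs _ _).trans (Finset.sum_le_sum fun j _ => ?_)
  rw [abs_mul]
  exact mul_le_mul_of_nonneg_left
    (le_ciSup (f := fun j => |y j|) (Set.finite_range _).bddAbove j) (abs_nonneg _)

/-- Hölder's inequality for `lpNorm`. -/
lemma abs_sum_mul_le_lpNorm_mul_lpNorm {p q : ℝ≥0∞} (hpq : p⁻¹ + q⁻¹ = 1) {d : ℕ}
    (x y : Fin d → ℝ) : |∑ j, x j * y j| ≤ lpNorm p x * lpNorm q y := by
  obtain ⟨rfl, rfl⟩ | ⟨rfl, rfl⟩ | ⟨hp, hq, h⟩ := conjugate_cases hpq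
  · rw [pi_lpNorm_top, pi_lpNorm_one, mul_comm]
    simpa only [mul_comm] using abs_sum_mul_le_sum_mul_iSup y x
  · rw [pi_lpNorm_top, pi_lpNorm_one]
    exact abs_sum_mul_le_sum_mul_iSup x y
  · rw [pi_lpNorm_of_ne_top hp, pi_lpNorm_of_ne_top hq]
    refine (Finset.abs_sum_le_sum_abs _ _).trans ?_
    simpa [abs_mul] using
      Real.inner_le_Lp_mul_Lq Finset.univ (fun j => |x j|) (fun j => |y j|) h

/-- Hölder's inequality is attained: `lpNorm p` is the dual norm of `lpNorm q`. -/
lemma exists_lpNorm_le_one_sum_mul_eq {p q : ℝ≥0∞} (hpq : p⁻¹ + q⁻¹ = 1) {d : ℕ}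
    (x : Fin d → ℝ) : ∃ v : Fin d → ℝ, lpNorm q v ≤ 1 ∧ ∑ j, x j * v j = lpNorm p x := by
  have abs_sign_le (r : ℝ) : |(SignType.sign r : ℝ)| ≤ 1 := by
    rcases lt_trichotomy r 0 with h | rfl | h <;> simp [*]
  obtain ⟨rfl, rfl⟩ | ⟨rfl, rfl⟩ | ⟨hp, hq, h⟩ := conjugate_cases hpq
  · simp only [pi_lpNorm_top, pi_lpNorm_one]
    rcases isEmpty_or_nonempty (Fin d) with hd | hd
    · exact ⟨0, by simp⟩
    · obtain ⟨k, hk⟩ := exists_eq_ciSup_of_finite (f := fun j => |x j|)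
      refine ⟨Pi.single k (SignType.sign (x k) : ℝ), ?_, ?_⟩
      · rw [Finset.sum_eq_single k (by intro b _ hb; simp [hb]) (by simp)]
        simpa using abs_sign_le (x k)
      · rw [Finset.sum_eq_single k (by intro b _ hb; simp [hb]) (by simp), ← hk]
        simp [self_mul_sign]
  · simp only [pi_lpNorm_top, pi_lpNorm_one]
    exact ⟨fun j => SignType.sign (x j), Real.iSup_le (fun j => abs_sign_le _) zero_le_one,
      by simp [self_mul_sign]⟩
  · obtain ⟨g, hg, hgx⟩ := (NNReal.isGreatest_Lp Finset.univ (fun j => ‖x j‖₊) h).1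
    simp only [Set.mem_ofPred_eq] at hg
    refine ⟨fun j => SignType.sign (x j) * g j, ?_, ?_⟩
    · rw [pi_lpNorm_of_ne_top hq]
      refine Real.rpow_le_one (by positivity) ?_ (by positivity)
      refine le_trans (b := ∑ j, (g j : ℝ) ^ q.toReal) (Finset.sum_le_sum fun j _ => ?_)
        (by exact_mod_cast hg)
      · refine Real.rpow_le_rpow (abs_nonneg _) ?_ ENNReal.toReal_nonneg
        rw [abs_mul, NNReal.abs_eq]
        exact mul_le_of_le_one_left (g j).2 (abs_sign_le _)
    · rw [pi_lpNorm_of_ne_top hp]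
      have := congrArg ((↑) : ℝ≥0 → ℝ) hgx
      simp only [NNReal.coe_sum, NNReal.coe_mul, coe_nnnorm, Real.norm_eq_abs, NNReal.coe_rpow]
        at this
      rw [← this]
      exact Finset.sum_congr rfl fun j _ => by rw [← mul_assoc, self_mul_sign]

lemma lintegral_empMeas {α : Type*} [MeasurableSpace α] [MeasurableSingletonClass α] {n : ℕ}
    (W : Fin n → α) (f : α → ℝ≥0∞) :
    ∫⁻ z, f z ∂(empMeas W) = (n : ℝ≥0∞)⁻¹ * ∑ i, f (W i) := by
  simp [empMeas, lintegral_finsetSum_measure]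

lemma lintegral_ofReal_empMeas {α : Type*} [MeasurableSpace α] [MeasurableSingletonClass α]
    {n : ℕ} (hn : 0 < n) (W : Fin n → α) {l : α → ℝ} (hl : ∀ z, 0 ≤ l z) :
    ∫⁻ z, ENNReal.ofReal (l z) ∂(empMeas W) = ENNReal.ofReal ((n : ℝ)⁻¹ * ∑ i, l (W i)) := by
  rw [lintegral_empMeas, ENNReal.ofReal_mul (by positivity),
    ENNReal.ofReal_sum_of_nonneg fun i _ => hl _, ENNReal.ofReal_inv_of_pos (by positivity),
    ENNReal.ofReal_natCast]

lemma map_empMeas {α γ : Type*} [MeasurableSpace α] [MeasurableSpace γ] {n : ℕ} (W : Fin n → α)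
    {f : α → γ} (hf : Measurable f) : (empMeas W).map f = empMeas (fun i => f (W i)) := by
  simp [empMeas, Measure.map_smul, Measure.map_finset_sum hf.aemeasurable, Measure.map_dirac' hf]

lemma isProbabilityMeasure_empMeas {α : Type*} [MeasurableSpace α] {n : ℕ} (hn : 0 < n)
    (W : Fin n → α) : IsProbabilityMeasure (empMeas W) := by
  constructor
  simp [empMeas, ENNReal.inv_mul_cancel, hn.ne']

lemma ae_empMeas {α : Type*} [MeasurableSpace α] [MeasurableSingletonClass α] {n : ℕ}
    {W : Fin n → α} {r : α → Prop} (h : ∀ i, r (W i)) : ∀ᵐ z ∂(empMeas W), r z := by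
  refine Measure.ae_smul_measure ?_ _
  rw [ae_finsetSum_measure_iff]
  intro i _
  simpa [ae_dirac_eq] using h i

lemma eExp_of_nonneg {α : Type*} [MeasurableSpace α] (P : Measure α) {l : α → ℝ}
    (hl : ∀ z, 0 ≤ l z) : eExp P l = ((∫⁻ z, ENNReal.ofReal (l z) ∂P : ℝ≥0∞) : EReal) := by
  simp [eExp, ENNReal.ofReal_of_nonpos, hl]

lemma EReal.coe_ciInf {ι : Type*} [Nonempty ι] {f : ι → ℝ} (hf : BddBelow (Set.range f)) :
    ((⨅ i, f i : ℝ) : EReal) = ⨅ i, (f i : EReal) :=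
  Monotone.map_ciInf_of_continuousAt continuous_coe_real_ereal.continuousAt
    EReal.coe_strictMono.monotone hf

/-- The hinge loss of the linear classifier `β` at the labelled point `z`. -/
def hinge {d : ℕ} (β : Fin d → ℝ) (z : (Fin d → ℝ) × ℝ) : ℝ :=
  max (1 - z.2 * ∑ j, β j * z.1 j) 0

lemma hinge_nonneg {d : ℕ} (β : Fin d → ℝ) (z : (Fin d → ℝ) × ℝ) : 0 ≤ hinge β z :=
  le_max_right _ _

lemma measurable_hinge {d : ℕ} (β : Fin d → ℝ) : Measurable (hinge β) := by
  unfold hinge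
  fun_prop

/-- The hinge loss is Lipschitz in the features, uniformly over labels of absolute value one. -/
lemma hinge_le_add {p q : ℝ≥0∞} (hpq : p⁻¹ + q⁻¹ = 1) {d : ℕ} (β x u : Fin d → ℝ) {y : ℝ}
    (hy : |y| = 1) :
    hinge β (x, y) ≤ hinge β (u, y) + lpNorm p β * lpNorm q (x - u) := by
  have hL := mul_nonneg (pi_lpNorm_nonneg p β) (pi_lpNorm_nonneg q (x - u))
  have h := abs_sum_mul_le_lpNorm_mul_lpNorm hpq β (x - u)
  rw [← one_mul |_|, ← hy, ← abs_mul] at h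
  have h2 := (abs_le.1 h).1
  simp only [Pi.sub_apply, mul_sub, Finset.sum_sub_distrib] at h2
  refine max_le ?_ (add_nonneg (hinge_nonneg _ _) hL)
  have := le_max_left (1 - y * ∑ j, β j * u j) 0
  simp only [hinge]
  linarith

section Cost

variable {d n : ℕ} {p q : ℝ≥0∞} {X : Fin n → Fin d → ℝ} {Y : Fin n → ℝ}
  {c : (Fin d → ℝ) × ℝ → (Fin d → ℝ) × ℝ → ℝ≥0∞}

lemma ofReal_hinge_le (hpq : p⁻¹ + q⁻¹ = 1)
    (hc : ∀ x y u v, c (x, y) (u, v) =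
      if y = v then ENNReal.ofReal (lpNorm q (x - u)) else ⊤)
    (β : Fin d → ℝ) (z w : (Fin d → ℝ) × ℝ) (hw : |w.2| = 1) :
    ENNReal.ofReal (hinge β z) ≤
      ENNReal.ofReal (hinge β w) + ENNReal.ofReal (lpNorm p β) * c z w := by
  obtain ⟨x, y⟩ := z
  obtain ⟨u, v⟩ := w
  rw [hc]
  split_ifs with h
  · subst h
    rw [← ENNReal.ofReal_mul (pi_lpNorm_nonneg _ _),
      ← ENNReal.ofReal_add (hinge_nonneg _ _)
        (mul_nonneg (pi_lpNorm_nonneg _ _) (pi_lpNorm_nonneg _ _))]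
    exact ENNReal.ofReal_le_ofReal (hinge_le_add hpq β x u hw)
  · rcases (pi_lpNorm_nonneg p β).eq_or_lt with h0 | h0
    · have hz (x : Fin d → ℝ) : ∑ j, β j * x j = 0 := by
        simpa [← h0] using abs_sum_mul_le_lpNorm_mul_lpNorm hpq β x
      simp [hinge, hz]
    · rw [ENNReal.mul_top (by simpa using h0)]
      simp

/-- The expected hinge loss of any measure near the empirical one is at most the penalized
empirical loss. -/
lemma lintegral_hinge_le (hn : 0 < n) (hpq : p⁻¹ + q⁻¹ = 1)
    (hY : ∀ i, |Y i| = 1)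
    (hc : ∀ x y u v, c (x, y) (u, v) =
      if y = v then ENNReal.ofReal (lpNorm q (x - u)) else ⊤)
    {δ : ℝ} (hδ : 0 < δ) (β : Fin d → ℝ) (P : Measure ((Fin d → ℝ) × ℝ))
    (hP : OTCost c P (empMeas (fun i => (X i, Y i))) ≤ ENNReal.ofReal δ) :
    ∫⁻ z, ENNReal.ofReal (hinge β z) ∂P ≤
      ENNReal.ofReal ((n : ℝ)⁻¹ * ∑ i, hinge β (X i, Y i) + δ * lpNorm p β) := by
  set R := (n : ℝ)⁻¹ * ∑ i, hinge β (X i, Y i)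
  have hR0 : 0 ≤ R := mul_nonneg (by positivity) (Finset.sum_nonneg fun i _ => hinge_nonneg _ _)
  have hL0 := pi_lpNorm_nonneg p β
  have hlim : Tendsto (fun t : ℝ => ENNReal.ofReal (R + t * lpNorm p β)) (𝓝[>] δ)
      (𝓝 (ENNReal.ofReal (R + δ * lpNorm p β))) := by
    have : Continuous fun t : ℝ => ENNReal.ofReal (R + t * lpNorm p β) :=
      ENNReal.continuous_ofReal.comp (by fun_prop)
    exact this.continuousAt.mono_left nhdsWithin_le_nhds
  refine ge_of_tendsto hlim ?_
  filter_upwards [self_mem_nhdsWithin] with t ht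
  have ht : δ < t := ht
  have hlt := hP.trans_lt ((ENNReal.ofReal_lt_ofReal_iff (hδ.trans ht)).2 ht)
  simp only [OTCost, iInf_lt_iff] at hlt
  obtain ⟨π, -, hπ1, hπ2, hπ⟩ := hlt
  have hm : Measurable fun z => ENNReal.ofReal (hinge β z) := (measurable_hinge β).ennreal_ofReal
  have hm2 : Measurable fun z : ((Fin d → ℝ) × ℝ) × ((Fin d → ℝ) × ℝ) =>
      ENNReal.ofReal (hinge β z.2) := hm.comp measurable_snd
  have hae : ∀ᵐ z ∂π, |z.2.2| = 1 := by
    have h : ∀ᵐ w ∂(π.map Prod.snd), |w.2| = 1 := by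
      rw [hπ2]
      exact ae_empMeas hY
    exact ae_of_ae_map measurable_snd.aemeasurable h
  calc ∫⁻ z, ENNReal.ofReal (hinge β z) ∂P
      = ∫⁻ z, ENNReal.ofReal (hinge β z.1) ∂π := by
        rw [← hπ1, lintegral_map hm measurable_fst]
    _ ≤ ∫⁻ z, (ENNReal.ofReal (hinge β z.2) + ENNReal.ofReal (lpNorm p β) * c z.1 z.2) ∂π :=
        lintegral_mono_ae (hae.mono fun z hz => ofReal_hinge_le hpq hc β z.1 z.2 hz)
    _ = ∫⁻ z, ENNReal.ofReal (hinge β z.2) ∂π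
          + ENNReal.ofReal (lpNorm p β) * ∫⁻ z, c z.1 z.2 ∂π := by
        rw [lintegral_add_left hm2, lintegral_const_mul' _ _ ENNReal.ofReal_ne_top]
    _ ≤ ENNReal.ofReal R + ENNReal.ofReal (lpNorm p β) * ENNReal.ofReal t := by
        gcongr
        rw [← lintegral_map (f := fun z => ENNReal.ofReal (hinge β z)) hm measurable_snd, hπ2,
          lintegral_ofReal_empMeas hn _ (hinge_nonneg β)]
    _ = ENNReal.ofReal (R + t * lpNorm p β) := by
        rw [← ENNReal.ofReal_mul hL0,
          ← ENNReal.ofReal_add hR0 (mul_nonneg hL0 (hδ.trans ht).le), mul_comm t]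

/-- The mixture moving a fraction `s` of every atom `W i` to `W' i`. -/
def mixMeas {α : Type*} [MeasurableSpace α] {n : ℕ} (s : ℝ) (W W' : Fin n → α) : Measure α :=
  ENNReal.ofReal (1 - s) • empMeas W + ENNReal.ofReal s • empMeas W'

lemma ofReal_one_sub_add_ofReal {s : ℝ} (hs0 : 0 ≤ s) (hs1 : s ≤ 1) :
    ENNReal.ofReal (1 - s) + ENNReal.ofReal s = 1 := by
  rw [← ENNReal.ofReal_add (by linarith) hs0]
  simp

lemma isProbabilityMeasure_mixMeas {α : Type*} [MeasurableSpace α] (hn : 0 < n) {s : ℝ}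
    (hs0 : 0 ≤ s) (hs1 : s ≤ 1) (W W' : Fin n → α) : IsProbabilityMeasure (mixMeas s W W') := by
  have := isProbabilityMeasure_empMeas hn W
  have := isProbabilityMeasure_empMeas hn W'
  constructor
  simp [mixMeas, ofReal_one_sub_add_ofReal hs0 hs1]

lemma map_mixMeas {α γ : Type*} [MeasurableSpace α] [MeasurableSpace γ] (s : ℝ)
    (W W' : Fin n → α) {f : α → γ} (hf : Measurable f) :
    (mixMeas s W W').map f = mixMeas s (fun i => f (W i)) (fun i => f (W' i)) := by
  simp [mixMeas, Measure.map_add _ _ hf, Measure.map_smul, map_empMeas _ hf]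

lemma OTCost_mixMeas_le {α : Type*} [MeasurableSpace α] [MeasurableSingletonClass (α × α)]
    (hn : 0 < n) {s : ℝ} (hs0 : 0 ≤ s) (hs1 : s ≤ 1) (k : α → α → ℝ≥0∞)
    (W W' : Fin n → α) {b : ℝ≥0∞}
    (hW : ∀ i, k (W i) (W i) = 0) (hW' : ∀ i, k (W' i) (W i) ≤ b) :
    OTCost k (mixMeas s W W') (empMeas W) ≤ ENNReal.ofReal s * b := by
  unfold OTCost
  refine iInf₂_le_of_le (mixMeas s (fun i => (W i, W i)) fun i => (W' i, W i))
    (isProbabilityMeasure_mixMeas hn hs0 hs1 _ _) ?_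
  refine iInf₂_le_of_le (map_mixMeas _ _ _ measurable_fst) ?_ ?_
  · rw [map_mixMeas _ _ _ measurable_snd]
    simp [mixMeas, ← add_smul, ofReal_one_sub_add_ofReal hs0 hs1]
  · simp only [mixMeas, lintegral_add_measure, lintegral_smul_measure, lintegral_empMeas, hW,
      smul_eq_mul, Finset.sum_const_zero, mul_zero, zero_add]
    gcongr
    calc (n : ℝ≥0∞)⁻¹ * ∑ i, k (W' i) (W i) ≤ (n : ℝ≥0∞)⁻¹ * ∑ _i : Fin n, b := by
          gcongr with i
          exact hW' i
      _ = b := by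
          simp [← mul_assoc, ENNReal.inv_mul_cancel, hn.ne']

/-- The penalized empirical loss is approached by moving a small fraction `s` of every atom by a
distance `δ / s` in the worst direction. -/
lemma exists_OTCost_le_le_lintegral_hinge (hn : 0 < n) (hq : 1 ≤ q) (hpq : p⁻¹ + q⁻¹ = 1)
    (hY : ∀ i, |Y i| = 1)
    (hc : ∀ x y u v, c (x, y) (u, v) =
      if y = v then ENNReal.ofReal (lpNorm q (x - u)) else ⊤)
    {δ : ℝ} (hδ : 0 < δ) (β : Fin d → ℝ) {s : ℝ} (hs0 : 0 < s) (hs1 : s ≤ 1) :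
    ∃ P : Measure ((Fin d → ℝ) × ℝ), IsProbabilityMeasure P ∧
      OTCost c P (empMeas (fun i => (X i, Y i))) ≤ ENNReal.ofReal δ ∧
      ENNReal.ofReal ((1 - s) * ((n : ℝ)⁻¹ * ∑ i, hinge β (X i, Y i))
          + s * ((n : ℝ)⁻¹ * ∑ i, (1 - Y i * ∑ j, β j * X i j)) + δ * lpNorm p β)
        ≤ ∫⁻ z, ENNReal.ofReal (hinge β z) ∂P := by
  obtain ⟨v, hv, hvβ⟩ := exists_lpNorm_le_one_sum_mul_eq hpq β
  have hδs : 0 ≤ δ / s := by positivity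
  refine ⟨mixMeas s (fun i => (X i, Y i)) (fun i => (X i + (-(Y i * (δ / s))) • v, Y i)),
    isProbabilityMeasure_mixMeas hn hs0.le hs1 _ _, ?_, ?_⟩
  · refine (OTCost_mixMeas_le (b := ENNReal.ofReal (δ / s)) hn hs0.le hs1 c _ _ (fun i => ?_)
      fun i => ?_).trans_eq ?_
    · have := pi_lpNorm_smul hq 0 (0 : Fin d → ℝ)
      rw [hc]
      simp_all
    · rw [hc, if_pos rfl, add_sub_cancel_left, pi_lpNorm_smul hq, abs_neg, abs_mul, hY, one_mul,
        abs_of_nonneg hδs]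
      exact ENNReal.ofReal_le_ofReal (mul_le_of_le_one_right hδs hv)
    · rw [← ENNReal.ofReal_mul hs0.le, mul_div_cancel₀ _ hs0.ne']
  · have hsum_nonneg (W : Fin n → (Fin d → ℝ) × ℝ) : 0 ≤ (n : ℝ)⁻¹ * ∑ i, hinge β (W i) :=
      mul_nonneg (by positivity) (Finset.sum_nonneg fun i _ => hinge_nonneg _ _)
    simp only [mixMeas, lintegral_add_measure, lintegral_smul_measure, smul_eq_mul,
      lintegral_ofReal_empMeas hn _ (hinge_nonneg β)]
    rw [← ENNReal.ofReal_mul (by linarith), ← ENNReal.ofReal_mul hs0.le,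
      ← ENNReal.ofReal_add (mul_nonneg (by linarith) (hsum_nonneg _))
        (mul_nonneg hs0.le (hsum_nonneg _)), add_assoc]
    refine ENNReal.ofReal_le_ofReal (add_le_add_right ?_ _)
    have hpt (i : Fin n) : (1 - Y i * ∑ j, β j * X i j) + δ / s * lpNorm p β
        ≤ hinge β (X i + (-(Y i * (δ / s))) • v, Y i) := by
      refine le_trans (le_of_eq ?_) (le_max_left _ _)
      have hYi : Y i * Y i = 1 := by rw [← abs_mul_abs_self, hY, one_mul]
      have hsum : ∑ j, β j * (X i + (-(Y i * (δ / s))) • v) j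
          = ∑ j, β j * X i j - Y i * (δ / s) * lpNorm p β := by
        rw [← hvβ, Finset.mul_sum, ← Finset.sum_sub_distrib]
        refine Finset.sum_congr rfl fun j _ => ?_
        simp only [Pi.add_apply, Pi.smul_apply, smul_eq_mul]
        ring
      simp only [hsum]
      linear_combination -(δ / s * lpNorm p β) * hYi
    have hn' : (n : ℝ) ≠ 0 := by exact_mod_cast hn.ne'
    calc s * ((n : ℝ)⁻¹ * ∑ i, (1 - Y i * ∑ j, β j * X i j)) + δ * lpNorm p β
        = s * ((n : ℝ)⁻¹ * ∑ i, ((1 - Y i * ∑ j, β j * X i j) + δ / s * lpNorm p β)) := by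
          rw [Finset.sum_add_distrib]
          simp only [Finset.sum_const, Finset.card_univ, Fintype.card_fin, nsmul_eq_mul]
          field_simp
      _ ≤ _ := by
          gcongr with i
          exact hpt i

/-- For fixed `β`, the worst-case expected hinge loss is the penalized empirical loss. -/
lemma iSup_eExp_hinge (hn : 0 < n) (hq : 1 ≤ q) (hpq : p⁻¹ + q⁻¹ = 1)
    (hY : ∀ i, |Y i| = 1)
    (hc : ∀ x y u v, c (x, y) (u, v) =
      if y = v then ENNReal.ofReal (lpNorm q (x - u)) else ⊤)
    {δ : ℝ} (hδ : 0 < δ) (β : Fin d → ℝ) :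
    (⨆ (P : Measure ((Fin d → ℝ) × ℝ)) (_ : IsProbabilityMeasure P)
        (_ : OTCost c P (empMeas (fun i => (X i, Y i))) ≤ ENNReal.ofReal δ), eExp P (hinge β))
      = (((n : ℝ)⁻¹ * ∑ i, hinge β (X i, Y i) + δ * lpNorm p β : ℝ) : EReal) := by
  simp only [eExp_of_nonneg _ (hinge_nonneg β)]
  refine le_antisymm (iSup_le fun P => iSup₂_le fun _ hP => ?_) ?_
  · refine (EReal.coe_ennreal_le_coe_ennreal_iff.2
      (lintegral_hinge_le (p := p) hn hpq hY hc hδ β P hP)).trans_eq ?_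
    rw [EReal.coe_ennreal_ofReal, max_eq_left]
    exact add_nonneg (mul_nonneg (by positivity) (Finset.sum_nonneg fun i _ => hinge_nonneg _ _))
      (mul_nonneg hδ.le (pi_lpNorm_nonneg _ _))
  · set R := (n : ℝ)⁻¹ * ∑ i, hinge β (X i, Y i)
    set A := (n : ℝ)⁻¹ * ∑ i, (1 - Y i * ∑ j, β j * X i j)
    have hlim : Tendsto (fun s : ℝ => (((1 - s) * R + s * A + δ * lpNorm p β : ℝ) : EReal))
        (𝓝[>] 0) (𝓝 ((R + δ * lpNorm p β : ℝ) : EReal)) := by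
      have : Continuous fun s : ℝ => (((1 - s) * R + s * A + δ * lpNorm p β : ℝ) : EReal) :=
        continuous_coe_real_ereal.comp (by fun_prop)
      simpa using (this.tendsto 0).mono_left (nhdsWithin_le_nhds (s := Set.Ioi 0))
    refine le_of_tendsto hlim ?_
    filter_upwards [Ioc_mem_nhdsGT (zero_lt_one' ℝ)] with s hs
    obtain ⟨P, hP, hPδ, hle⟩ :=
      exists_OTCost_le_le_lintegral_hinge hn hq hpq hY hc hδ β hs.1 hs.2
    refine le_iSup_of_le P (le_iSup₂_of_le hP hPδ ?_)
    refine le_trans ?_ (EReal.coe_ennreal_le_coe_ennreal_iff.2 hle)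
    rw [EReal.coe_ennreal_ofReal]
    exact_mod_cast le_max_left _ _

end Cost

/-- distributionally robust representation of support vector machines: with
the hinge loss `l(x,y;β) = (1 - y βᵀx)⁺`, binary labels `Y_i ∈ {-1,+1}`, and cost
`N_q((x,y),(u,v)) = ‖x-u‖_q` if `y = v`, `+∞` otherwise, with `q ∈ [1,∞]`,
`1/p + 1/q = 1`: for every `δ > 0`,
`min_β sup { E_P[(1-YβᵀX)⁺] : D_c(P,P_n) ≤ δ }
  = min_β { (1/n) ∑ᵢ (1-Yᵢ βᵀXᵢ)⁺ + δ ‖β‖_p }`. -/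
theorem dr_svm_hinge_loss_representation
    (d n : ℕ) (hn : 0 < n)
    (q p : ℝ≥0∞) (hq : 1 ≤ q) (hpq : p⁻¹ + q⁻¹ = 1)
    (X : Fin n → (Fin d → ℝ)) (Y : Fin n → ℝ) (hY : ∀ i, Y i = 1 ∨ Y i = -1)
    (c : ((Fin d → ℝ) × ℝ) → ((Fin d → ℝ) × ℝ) → ℝ≥0∞)
    (hc : ∀ x y u v, c (x, y) (u, v) =
      if y = v then ENNReal.ofReal (lpNorm q (x - u)) else ⊤)
    (δ : ℝ) (hδ : 0 < δ) :
    (⨅ β : Fin d → ℝ,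
        ⨆ (P : Measure ((Fin d → ℝ) × ℝ)) (_ : IsProbabilityMeasure P)
          (_ : OTCost c P (empMeas (fun i => (X i, Y i))) ≤ ENNReal.ofReal δ),
          eExp P (fun z => max (1 - z.2 * ∑ j, β j * z.1 j) 0))
      = ((⨅ β : Fin d → ℝ,
            ((n : ℝ)⁻¹ * ∑ i, max (1 - Y i * ∑ j, β j * X i j) 0
              + δ * lpNorm p β : ℝ) : ℝ) : EReal) := by
  have hY' (i : Fin n) : |Y i| = 1 := by rcases hY i with h | h <;> simp [h]
  rw [EReal.coe_ciInf]
  · exact iInf_congr fun β => iSup_eExp_hinge hn hq hpq hY' hc hδ β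
  · refine ⟨0, ?_⟩
    rintro _ ⟨β, rfl⟩
    exact add_nonneg (mul_nonneg (by positivity) (Finset.sum_nonneg fun i _ => le_max_right _ _))
      (mul_nonneg hδ.le (pi_lpNorm_nonneg _ _))
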